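/- Suppose X is an ACM set of distinct points in ℙ^{n_1} × ⋯ × ℙ^{n_k}. Then there exist homogeneous elements L_1,…,L_k of R with deg L_i = e_i for every i, such that L_1,…,L_k give rise to a regular sequence in R/I_X. -/

import Mathlib

open MvPolynomial

noncomputable section

namespace PaperMP

variable (K : Type) [Field K] [IsAlgClosed K] [CharZero K]
variable (k : ℕ) (n : Fin k → ℕ)

/-- Index type of the variables `x_{i,j}`, `1 ≤ i ≤ k`, `0 ≤ j ≤ n i`. -/
abbrev Sig := Σ i : Fin k, Fin (n i + 1)

/-- The `ℕ^k`-graded polynomial ring `R`. -/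
abbrev MPRing := MvPolynomial (Sig k n) K

/-- The grading of `R`: `deg x_{i,j} = e_i`. -/
def wt : Sig k n → (Fin k → ℕ) := fun p => Pi.single p.1 1

/-- A point of `ℙ^{n_1} × ⋯ × ℙ^{n_k}`. -/
abbrev MPPoint := ∀ i : Fin k, Projectivization K (Fin (n i + 1) → K)

/-- The affine cone over a point of multiprojective space. -/
def cone (P : MPPoint K k n) : Set (Sig k n → K) :=
  {x | ∀ i : Fin k, ∃ c : K, (fun j => x ⟨i, j⟩) = c • (P i).rep}

/-- Vanishing ideal of a set of points of affine space. -/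
def vanishingIdeal (T : Set (Sig k n → K)) : Ideal (MPRing K k n) :=
  ⨅ x ∈ T, RingHom.ker (MvPolynomial.eval x)

/-- The (prime) ideal `I_P` of a point of multiprojective space. -/
def idealOfPoint (P : MPPoint K k n) : Ideal (MPRing K k n) :=
  vanishingIdeal K k n (cone K k n P)

/-- The ideal `I_X` of a set of points of multiprojective space. -/
def idealOfSet (X : Set (MPPoint K k n)) : Ideal (MPRing K k n) :=
  ⨅ P ∈ X, idealOfPoint K k n P

/-- The Hilbert function of `R/I` in multidegree `d`. -/
def hilb (I : Ideal (MPRing K k n)) (d : Fin k → ℕ) : ℕ :=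
  Module.finrank K ((weightedHomogeneousSubmodule K (wt k n) d).map
    (Ideal.Quotient.mkₐ K I).toLinearMap)

/-- The irrelevant maximal ideal `m = (x_{1,0},…,x_{k,n_k})`. -/
def maxIdeal : Ideal (MPRing K k n) :=
  Ideal.span (Set.range (MvPolynomial.X : Sig k n → MPRing K k n))

/-- `L` is a regular sequence modulo `I`:  `(I,L) ⊆ m`, and each entry is a
non-zero divisor modulo `I` together with the previous entries. -/
def IsRegSeqMod (I : Ideal (MPRing K k n)) (L : List (MPRing K k n)) : Prop :=
  I ⊔ Ideal.span {f | f ∈ L} ≤ maxIdeal K k n ∧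
  ∀ i : Fin L.length, ∀ G : MPRing K k n,
    L.get i * G ∈ I ⊔ Ideal.span {f | f ∈ L.take i} →
      G ∈ I ⊔ Ideal.span {f | f ∈ L.take i}

/-- `depth R/I = l`: `l` is the length of a maximal regular sequence modulo `I`. -/
def hasDepth (I : Ideal (MPRing K k n)) (l : ℕ) : Prop :=
  IsGreatest {r : ℕ | ∃ L : List (MPRing K k n), L.length = r ∧ IsRegSeqMod K k n I L} l

/-- `X` is arithmetically Cohen–Macaulay: `depth R/I_X = K-dim R/I_X = k`. -/
def IsACM (X : Set (MPPoint K k n)) : Prop :=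
  hasDepth K k n (idealOfSet K k n X) k

/-! ### The first difference function -/

/-- Extend `H : ℕ^k → ℕ` by zero outside ℕ^k. -/
def extNeg (H : (Fin k → ℕ) → ℕ) (j : Fin k → ℤ) : ℤ :=
  if ∀ i, 0 ≤ j i then H (fun i => (j i).toNat) else 0

/-- The first difference function `ΔH` of a numerical function `H : ℕ^k → ℕ`. -/
def delta (H : (Fin k → ℕ) → ℕ) (d : Fin k → ℕ) : ℤ :=
  ∑ l : Fin k → Fin 2, (-1 : ℤ) ^ (∑ i, (l i : ℕ)) *
    extNeg k H (fun i => (d i : ℤ) - (l i : ℕ))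

/-! ### The ring `S = k[x_{1,1},…,x_{k,n_k}]` -/

/-- Index type of the variables `x_{i,j}`, `1 ≤ i ≤ k`, `1 ≤ j ≤ n i`. -/
abbrev SigS := Σ i : Fin k, Fin (n i)

/-- The `ℕ^k`-graded polynomial ring `S`. -/
abbrev SRing := MvPolynomial (SigS k n) K

/-- The grading of `S`: `deg x_{i,j} = e_i`. -/
def wtS : SigS k n → (Fin k → ℕ) := fun p => Pi.single p.1 1

/-- The Hilbert function of `S/J` in multidegree `d`. -/
def hilbS (J : Ideal (SRing K k n)) (d : Fin k → ℕ) : ℕ :=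
  Module.finrank K ((weightedHomogeneousSubmodule K (wtS k n) d).map
    (Ideal.Quotient.mkₐ K J).toLinearMap)

/-- `J` is an `ℕ^k`-homogeneous ideal of `S`. -/
def IsHomogIdealS (J : Ideal (SRing K k n)) : Prop :=
  ∀ f ∈ J, ∀ d : Fin k → ℕ, weightedHomogeneousComponent (wtS k n) d f ∈ J

/-- `J` is an artinian ideal of `S`: `√J = (x_{1,1},…,x_{k,n_k})`. -/
def IsArtinianIdealS (J : Ideal (SRing K k n)) : Prop :=
  J.radical = Ideal.span (Set.range (MvPolynomial.X : SigS k n → SRing K k n))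

/-! ### The ring `k[x_1,…,x_k]`, with `deg x_i = e_i` -/

abbrev TRing := MvPolynomial (Fin k) K

/-- The grading: `deg x_i = e_i`. -/
def wtT : Fin k → (Fin k → ℕ) := fun i => Pi.single i 1

/-- The Hilbert function of `k[x_1,…,x_k]/I` in multidegree `d`. -/
def hilbT (I : Ideal (TRing K k)) (d : Fin k → ℕ) : ℕ :=
  Module.finrank K ((weightedHomogeneousSubmodule K (wtT k) d).map
    (Ideal.Quotient.mkₐ K I).toLinearMap)

/-- `I` is an `ℕ^k`-homogeneous ideal of `k[x_1,…,x_k]`. -/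
def IsHomogIdealT (I : Ideal (TRing K k)) : Prop :=
  ∀ f ∈ I, ∀ d : Fin k → ℕ, weightedHomogeneousComponent (wtT k) d f ∈ I

/-- `I` is an artinian ideal of `k[x_1,…,x_k]`: `√I = (x_1,…,x_k)`. -/
def IsArtinianIdealT (I : Ideal (TRing K k)) : Prop :=
  I.radical = Ideal.span (Set.range (MvPolynomial.X : Fin k → TRing K k))

/-! ### Lifting monomial ideals -/

/-- The lift `m̄ = ∏_{i,j} ∏_{l=1}^{a_{i,j}} (x_{i,j} - (l-1) x_{i,0})` of the monomial
of `S` with exponent vector `b`, via the lifting matrix `𝒜`. -/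
def liftMonomial (b : SigS k n →₀ ℕ) : MPRing K k n :=
  ∏ p ∈ b.support, ∏ l ∈ Finset.range (b p),
    (MvPolynomial.X (⟨p.1, p.2.succ⟩ : Sig k n) - (l : MPRing K k n) * MvPolynomial.X ⟨p.1, 0⟩)

/-- `J` is a monomial ideal of `S`. -/
def IsMonomialIdeal (J : Ideal (SRing K k n)) : Prop :=
  ∃ A : Set (SigS k n →₀ ℕ), J = Ideal.span ((fun b => (monomial b (1 : K) : SRing K k n)) '' A)

/-- The exponent vectors of the minimal monomial generators of a monomial ideal `J ⊆ S`. -/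
def minGens (J : Ideal (SRing K k n)) : Set (SigS k n →₀ ℕ) :=
  {b | (monomial b (1 : K) : SRing K k n) ∈ J ∧
    ∀ b' : SigS k n →₀ ℕ, b' ≤ b → b' ≠ b → (monomial b' (1 : K) : SRing K k n) ∉ J}

/-- The lift to `R` of a monomial ideal `J ⊆ S`, generated by the lifts of the
minimal monomial generators of `J`. -/
def liftIdeal (J : Ideal (SRing K k n)) : Ideal (MPRing K k n) :=
  Ideal.span (liftMonomial K k n '' minGens K k n J)

/-- The projection `R → S ≅ R/(x_{1,0},…,x_{k,0})` sending `x_{i,0} ↦ 0` and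
`x_{i,j} ↦ x_{i,j}` for `j ≥ 1`. -/
def projToS : MPRing K k n →ₐ[K] SRing K k n :=
  aeval (fun p : Sig k n =>
    if h : p.2 = 0 then 0 else MvPolynomial.X (⟨p.1, p.2.pred h⟩ : SigS k n))

/-- The point `[1:b_{i,1}:⋯:b_{i,n_i}] × ⋯` of multiprojective space associated to the
exponent vector `b` of a monomial of `S`. -/
def monToPoint (b : SigS k n →₀ ℕ) : MPPoint K k n := fun i =>
  Projectivization.mk K
    (fun j : Fin (n i + 1) => if h : j = 0 then 1 else ((b ⟨i, j.pred h⟩ : ℕ) : K))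
    (fun hc => by simpa using congrFun hc 0)

/-! ### Partitions -/

/-- `lam` is a partition: positive non-increasing entries. -/
def IsPartition {t : ℕ} (lam : Fin t → ℕ) : Prop :=
  (∀ j, 0 < lam j) ∧ Antitone lam

/-- `lam` is a partition of `s`. -/
def IsPartitionOf (s : ℕ) {t : ℕ} (lam : Fin t → ℕ) : Prop :=
  IsPartition lam ∧ ∑ j, lam j = s

/-- The `(i+1)`-st entry `λ*_{i+1} = #{j : λ_j ≥ i+1}` of the conjugate partition. -/
def conjEntry {t : ℕ} (lam : Fin t → ℕ) (i : ℕ) : ℕ :=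
  (Finset.univ.filter fun j : Fin t => i + 1 ≤ lam j).card

/-- `β` is the conjugate partition `α*` of `α`. -/
def IsConjugateOf {t m : ℕ} (α : Fin t → ℕ) (β : Fin m → ℕ) : Prop :=
  (∀ i : Fin m, β i = conjEntry α i) ∧ ∀ i : ℕ, m ≤ i → conjEntry α i = 0

/-! ### `ℙ^1 × ℙ^1` -/

/-- A point of `ℙ^1`. -/
abbrev Proj1 := Projectivization K (Fin 2 → K)

/-- A point of `ℙ^1 × ℙ^1`. -/
abbrev Pt2 := MPPoint K 2 (fun _ => 1)

/-- The coordinate ring of `ℙ^1 × ℙ^1`. -/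
abbrev R2 := MPRing K 2 (fun _ => 1)

/-- `P` enumerates the distinct first coordinates of `X` and `α` lists the sizes of the
corresponding fibers, in non-increasing order; so `α = α_X`. -/
def IsAlphaLabel (X : Set (Pt2 K)) {t : ℕ} (P : Fin t → Proj1 K) (α : Fin t → ℕ) : Prop :=
  Function.Injective P ∧ (Set.range P = (fun Z : Pt2 K => Z 0) '' X) ∧
  (∀ i, α i = Set.ncard {Z | Z ∈ X ∧ Z 0 = P i}) ∧ Antitone α

/-- `Q` enumerates the distinct second coordinates of `X` and `β` lists the sizes of the
corresponding fibers, in non-increasing order; so `β = β_X`. -/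
def IsBetaLabel (X : Set (Pt2 K)) {r : ℕ} (Q : Fin r → Proj1 K) (β : Fin r → ℕ) : Prop :=
  Function.Injective Q ∧ (Set.range Q = (fun Z : Pt2 K => Z 1) '' X) ∧
  (∀ i, β i = Set.ncard {Z | Z ∈ X ∧ Z 1 = Q i}) ∧ Antitone β

/-- `α = α_X`. -/
def IsAlphaPartition (X : Set (Pt2 K)) {t : ℕ} (α : Fin t → ℕ) : Prop :=
  ∃ P : Fin t → Proj1 K, IsAlphaLabel K X P α

/-- `β = β_X`. -/
def IsBetaPartition (X : Set (Pt2 K)) {r : ℕ} (β : Fin r → ℕ) : Prop :=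
  ∃ Q : Fin r → Proj1 K, IsBetaLabel K X Q β

/-- `F` is "the" form of degree `(1,0)` vanishing at all points of `ℙ^1 × ℙ^1` whose
first coordinate is `P`. -/
def IsForm1Of (P : Proj1 K) (F : R2 K) : Prop :=
  IsWeightedHomogeneous (wt 2 (fun _ => 1)) F (Pi.single 0 1) ∧ F ≠ 0 ∧
  ∀ x : Sig 2 (fun _ => 1) → K,
    (∃ c : K, (fun j : Fin 2 => x ⟨0, j⟩) = c • P.rep) → MvPolynomial.eval x F = 0

/-- `F` is "the" form of degree `(0,1)` vanishing at all points of `ℙ^1 × ℙ^1` whose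
second coordinate is `P`. -/
def IsForm2Of (P : Proj1 K) (F : R2 K) : Prop :=
  IsWeightedHomogeneous (wt 2 (fun _ => 1)) F (Pi.single 1 1) ∧ F ≠ 0 ∧
  ∀ x : Sig 2 (fun _ => 1) → K,
    (∃ c : K, (fun j : Fin 2 => x ⟨1, j⟩) = c • P.rep) → MvPolynomial.eval x F = 0

end PaperMP

section RegularSequences

variable {R : Type*} [CommRing R]

/-- `x` is a non-zero divisor modulo the ideal `J`. -/
def RegularMod (J : Ideal R) (x : R) : Prop := ∀ g, x * g ∈ J → g ∈ J

/-- There is a regular sequence of length `r` modulo `J` whose entries lie in `m`. -/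
def HasRegularSeqMod (m : Ideal R) : Ideal R → ℕ → Prop
  | _, 0 => True
  | J, r + 1 => ∃ x ∈ m, RegularMod J x ∧ HasRegularSeqMod m (J ⊔ Ideal.span {x}) r

theorem mem_sup_span_singleton_iff {J : Ideal R} {x a : R} :
    a ∈ J ⊔ Ideal.span {x} ↔ ∃ c, a - x * c ∈ J := by
  rw [Submodule.mem_sup]
  constructor
  · rintro ⟨j, hj, y, hy, rfl⟩
    obtain ⟨c, rfl⟩ := Ideal.mem_span_singleton'.1 hy
    exact ⟨c, by simpa [mul_comm] using hj⟩
  · rintro ⟨c, hc⟩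
    exact ⟨_, hc, _, Ideal.mul_mem_right c _ (Ideal.mem_span_singleton_self x), by ring⟩

theorem RegularMod.swap {J : Ideal R} {y z : R}
    (hyz : RegularMod (J ⊔ Ideal.span {y}) z) (hy : RegularMod J y) :
    RegularMod (J ⊔ Ideal.span {z}) y := by
  intro u hu
  obtain ⟨v, hv⟩ := mem_sup_span_singleton_iff.1 hu
  have hv' : v ∈ J ⊔ Ideal.span {y} :=
    hyz _ (mem_sup_span_singleton_iff.2 ⟨u, by rw [← neg_mem_iff]; simpa using hv⟩)
  obtain ⟨w, hw⟩ := mem_sup_span_singleton_iff.1 hv'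
  refine mem_sup_span_singleton_iff.2 ⟨w, hy _ ?_⟩
  have := J.add_mem hv (J.mul_mem_left z hw)
  convert this using 1
  ring

/-- A maximal ideal is associated to `R/(J, x)` only if it is associated to `R/(J, y)`, for
`x`, `y` regular modulo `J` in that ideal. -/
theorem mem_sup_span_of_forall_mul_mem {m J : Ideal R} {x y : R} (hym : y ∈ m)
    (hx : RegularMod J x) (hy : RegularMod J y)
    (h : ∀ u, (∀ a ∈ m, a * u ∈ J ⊔ Ideal.span {y}) → u ∈ J ⊔ Ideal.span {y}) (u : R)
    (hu : ∀ a ∈ m, a * u ∈ J ⊔ Ideal.span {x}) : u ∈ J ⊔ Ideal.span {x} := by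
  obtain ⟨v, hv⟩ := mem_sup_span_singleton_iff.1 (hu y hym)
  have hv' : v ∈ J ⊔ Ideal.span {y} := by
    refine h v fun a ha ↦ ?_
    obtain ⟨w, hw⟩ := mem_sup_span_singleton_iff.1 (hu a ha)
    refine mem_sup_span_singleton_iff.2 ⟨w, hx _ ?_⟩
    have := J.sub_mem (J.mul_mem_left y hw) (J.mul_mem_left a hv)
    convert this using 1
    ring
  obtain ⟨w, hw⟩ := mem_sup_span_singleton_iff.1 hv'
  refine mem_sup_span_singleton_iff.2 ⟨w, hy _ ?_⟩
  have := J.add_mem hv (J.mul_mem_left x hw)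
  convert this using 1
  ring

variable [IsNoetherianRing R]

theorem mem_associatedPrimes_quotient_iff {J p : Ideal R} :
    p ∈ associatedPrimes R (R ⧸ J) ↔ p.IsPrime ∧ ∃ w, ∀ a, a ∈ p ↔ a * w ∈ J := by
  rw [AssociatedPrimes.mem_iff, isAssociatedPrime_iff, and_congr_right_iff]
  intro _
  have key : ∀ w a, a ∈ (⊥ : Submodule R (R ⧸ J)).colon {Ideal.Quotient.mk J w} ↔ a * w ∈ J := by
    intro w a
    rw [Submodule.mem_colon_singleton, Submodule.mem_bot, ← Ideal.Quotient.eq_zero_iff_mem,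
      map_mul]
    rfl
  constructor
  · rintro ⟨x, rfl⟩
    obtain ⟨w, rfl⟩ := Ideal.Quotient.mk_surjective x
    exact ⟨w, key w⟩
  · rintro ⟨w, hw⟩
    exact ⟨Ideal.Quotient.mk J w, by ext a; rw [key, hw]⟩

theorem exists_associatedPrime_le {J m : Ideal R} [m.IsPrime] {u : R}
    (h : ∀ a, a * u ∈ J → a ∈ m) :
    ∃ q ∈ associatedPrimes R (R ⧸ J), q ≤ m ∧ ∀ a, a * u ∈ J → a ∈ q := by
  obtain ⟨q, hq, hqm⟩ := Ideal.exists_minimalPrimes_le (I := Submodule.colon J {u}) (J := m)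
    (fun a ha ↦ h a (Submodule.mem_colon_singleton.1 ha))
  obtain ⟨w, hw⟩ := Submodule.exists_eq_colon_of_mem_minimalPrimes hq
  refine ⟨q, mem_associatedPrimes_quotient_iff.2 ⟨hq.1.1, w, fun a ↦ ?_⟩, hqm,
    fun a ha ↦ hq.1.2 (Submodule.mem_colon_singleton.2 ha)⟩
  conv_lhs => rw [hw]
  exact Submodule.mem_colon_singleton

theorem exists_regularMod {ι : Type*} [Finite ι] {m : Ideal R} [m.IsMaximal] (J : ι → Ideal R)
    (h : ∀ i u, (∀ a ∈ m, a * u ∈ J i) → u ∈ J i) : ∃ z ∈ m, ∀ i, RegularMod (J i) z := by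
  by_contra! hcon
  have hfin : (⋃ i, associatedPrimes R (R ⧸ J i)).Finite :=
    Set.finite_iUnion fun i ↦ associatedPrimes.finite R (R ⧸ J i)
  obtain ⟨p, hp, hmp⟩ := (m.subset_union_prime_finite hfin (f := id) 0 0
    (fun p hp _ _ ↦ by
      obtain ⟨i, hi⟩ := Set.mem_iUnion.1 hp
      exact hi.isPrime)).1 (fun z hz ↦ by
    obtain ⟨i, hi⟩ := hcon z hz
    simp only [RegularMod, not_forall] at hi
    obtain ⟨g, hg, hgJ⟩ := hi
    have hz' : z ∈ ⋃ p ∈ associatedPrimes R (R ⧸ J i), (p : Set R) := by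
      rw [biUnion_associatedPrimes_eq_zero_divisors]
      refine ⟨Ideal.Quotient.mk _ g, by rwa [Ne, Ideal.Quotient.eq_zero_iff_mem], ?_⟩
      exact Ideal.Quotient.eq_zero_iff_mem.2 hg
    obtain ⟨p, hp, hzp⟩ := Set.mem_iUnion₂.1 hz'
    exact Set.mem_iUnion₂.2 ⟨p, Set.mem_iUnion.2 ⟨i, hp⟩, hzp⟩)
  obtain ⟨i, hi⟩ := Set.mem_iUnion.1 hp
  obtain ⟨hpp, w, hw⟩ := mem_associatedPrimes_quotient_iff.1 hi
  have hwJ := h i w fun a ha ↦ (hw a).1 (hmp ha)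
  exact hpp.ne_top ((Ideal.eq_top_iff_one _).2 ((hw 1).2 (by simpa using hwJ)))

/-- Quotienting by a regular element of a maximal ideal drops the depth by at most one. -/
theorem HasRegularSeqMod.sup_span {m : Ideal R} [m.IsMaximal] {r : ℕ} :
    ∀ {J : Ideal R}, HasRegularSeqMod m J (r + 1) → ∀ {x}, x ∈ m → RegularMod J x →
      HasRegularSeqMod m (J ⊔ Ideal.span {x}) r := by
  induction r with
  | zero => intros; trivial
  | succ r ih =>
    rintro J ⟨y, hym, hy, hJy⟩ x hxm hx
    obtain ⟨y₂, hy₂m, hy₂, -⟩ := id hJy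
    have hm : ∀ u, (∀ a ∈ m, a * u ∈ J ⊔ Ideal.span {y}) → u ∈ J ⊔ Ideal.span {y} :=
      fun u hu ↦ hy₂ u (hu y₂ hy₂m)
    obtain ⟨z, hzm, hz⟩ := exists_regularMod (m := m)
      ![J ⊔ Ideal.span {x}, J ⊔ Ideal.span {y}] (by
        intro i
        fin_cases i
        · exact mem_sup_span_of_forall_mul_mem hym hx hy hm
        · exact hm)
    have hzx : RegularMod (J ⊔ Ideal.span {x}) z := hz 0
    have hzy : RegularMod (J ⊔ Ideal.span {y}) z := hz 1
    have h₁ : HasRegularSeqMod m (J ⊔ Ideal.span {z}) (r + 1) := by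
      refine ⟨y, hym, hzy.swap hy, ?_⟩
      rw [sup_right_comm]
      exact ih hJy hzm hzy
    refine ⟨z, hzm, hzx, ?_⟩
    rw [sup_right_comm]
    exact ih h₁ hxm (hzx.swap hx)

theorem exists_associatedPrime_sup_span {m J p : Ideal R} [m.IsMaximal]
    (hp : p ∈ associatedPrimes R (R ⧸ J)) (hpm : p ≤ m) {x : R} (hxm : x ∈ m)
    (hx : RegularMod J x) :
    ∃ q ∈ associatedPrimes R (R ⧸ (J ⊔ Ideal.span {x})), q ≤ m ∧ p ⊔ Ideal.span {x} ≤ q := by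
  obtain ⟨hpp, u, hu⟩ := mem_associatedPrimes_quotient_iff.1 hp
  let U : Ideal R := Submodule.colon J (p : Set R)
  have hU : ∀ v, v ∈ U ↔ ∀ a ∈ p, v * a ∈ J := fun v ↦ by
    simp [U, Submodule.mem_colon]
  suffices h : ∃ v ∈ U, ∀ a, a * v ∈ J ⊔ Ideal.span {x} → a ∈ m by
    obtain ⟨v, hv, hvm⟩ := h
    obtain ⟨q, hq, hqm, hvq⟩ := exists_associatedPrime_le hvm
    refine ⟨q, hq, hqm, sup_le (fun a ha ↦ hvq a ?_) ?_⟩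
    · exact Ideal.mem_sup_left (by rw [mul_comm]; exact (hU v).1 hv a ha)
    · rw [Ideal.span_singleton_le_iff_mem]
      exact hvq x (Ideal.mem_sup_right (Ideal.mul_mem_right _ _ (Ideal.mem_span_singleton_self x)))
  by_contra! hcon
  have hle : U ≤ J ⊔ m • U := by
    intro v hv
    obtain ⟨s, hs, hsm⟩ := hcon v hv
    obtain ⟨w, hw⟩ := mem_sup_span_singleton_iff.1 hs
    have hwU : w ∈ U := (hU w).2 fun a ha ↦ hx _ (by
      have h1 := J.mul_mem_left s ((hU v).1 hv a ha)
      have h2 := J.sub_mem h1 (J.mul_mem_right a hw)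
      convert h2 using 1
      ring)
    obtain ⟨t, i, him, hti⟩ := (Ideal.IsMaximal.exists_inv ‹m.IsMaximal› hsm)
    have : v = t * (s * v - x * w) + (i * v + x * (t * w)) := by
      linear_combination (-v) * hti
    rw [this]
    refine Submodule.add_mem_sup (J.mul_mem_left t hw) (add_mem ?_ ?_)
    · exact Submodule.smul_mem_smul him hv
    · exact Submodule.smul_mem_smul hxm (U.mul_mem_left t hwU)
  obtain ⟨r, hr, hrU⟩ := Submodule.exists_sub_one_mem_and_smul_le_of_fg_of_le_sup
    (IsNoetherian.noetherian U) le_rfl hle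
  have huU : u ∈ U := (hU u).2 fun a ha ↦ by rw [mul_comm]; exact (hu a).1 ha
  have hrm : r ∈ m := hpm ((hu r).2 (hrU (Submodule.smul_mem_pointwise_smul u r U huU)))
  exact ‹m.IsMaximal›.ne_top ((Ideal.eq_top_iff_one _).2 (by simpa using m.sub_mem hrm hr))

/-- The depth of `R/J` is at most the dimension of `R/p` for each associated prime `p`. -/
theorem HasRegularSeqMod.le_coheight {m : Ideal R} [m.IsMaximal] {r : ℕ} :
    ∀ {J : Ideal R}, HasRegularSeqMod m J r → ∀ (p : PrimeSpectrum R),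
      p.asIdeal ∈ associatedPrimes R (R ⧸ J) → p.asIdeal ≤ m → (r : ℕ∞) ≤ Order.coheight p := by
  induction r with
  | zero => intros; simp
  | succ r ih =>
    rintro J ⟨x, hxm, hx, hJx⟩ p hp hpm
    obtain ⟨q, hq, hqm, hpq⟩ := exists_associatedPrime_sup_span hp hpm hxm hx
    let q' : PrimeSpectrum R := ⟨q, hq.isPrime⟩
    have hlt : p < q' := by
      refine lt_of_le_of_ne (le_sup_left.trans hpq) fun heq ↦ ?_
      obtain ⟨hpp, u, hu⟩ := mem_associatedPrimes_quotient_iff.1 hp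
      have hxp : x ∈ p.asIdeal := by
        rw [heq]
        exact hpq (Ideal.mem_sup_right (Ideal.mem_span_singleton_self x))
      exact hpp.ne_top ((Ideal.eq_top_iff_one _).2
        ((hu 1).2 (by simpa using hx u ((hu x).1 hxp))))
    calc ((r + 1 : ℕ) : ℕ∞) ≤ Order.coheight q' + 1 := by
          push_cast
          gcongr
          exact ih hJx q' hq hqm
      _ ≤ Order.coheight p := Order.coheight_add_one_le hlt

theorem HasRegularSeqMod.le_ringKrullDim {m J : Ideal R} [m.IsMaximal] {r : ℕ}
    (h : HasRegularSeqMod m J r) {p : Ideal R} (hp : p ∈ associatedPrimes R (R ⧸ J))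
    (hpm : p ≤ m) : (r : WithBot ℕ∞) ≤ ringKrullDim (R ⧸ p) := by
  have h1 := h.le_coheight ⟨p, hp.isPrime⟩ hp hpm
  rw [ringKrullDim_quotient]
  have h2 := Order.coheight_eq_krullDim_Ici (⟨p, hp.isPrime⟩ : PrimeSpectrum R)
  have h3 : PrimeSpectrum.zeroLocus (p : Set R) = Set.Ici ⟨p, hp.isPrime⟩ := by
    ext q; rfl
  rw [h3, ← h2]
  exact_mod_cast h1

end RegularSequences

section RegularChains

variable {R : Type*} [CommRing R]

/-- Every entry of `L` is a non-zero divisor modulo `J` together with the previous entries. -/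
def RegularChain (J : Ideal R) (L : List R) : Prop :=
  ∀ i : Fin L.length, RegularMod (J ⊔ Ideal.span {f | f ∈ L.take i}) (L.get i)

theorem sup_span_cons (J : Ideal R) (x : R) (L : List R) :
    J ⊔ Ideal.span {f | f ∈ x :: L} = J ⊔ Ideal.span {x} ⊔ Ideal.span {f | f ∈ L} := by
  rw [sup_assoc, ← Ideal.span_union]
  congr 2
  ext f
  simp

theorem regularChain_cons {J : Ideal R} {x : R} {L : List R} :
    RegularChain J (x :: L) ↔ RegularMod J x ∧ RegularChain (J ⊔ Ideal.span {x}) L := by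
  unfold RegularChain
  refine (Fin.forall_fin_succ (n := L.length)).trans (and_congr ?_ (forall_congr' fun i ↦ ?_))
  · simp
  · change RegularMod (J ⊔ Ideal.span {f | f ∈ x :: L.take i}) _ ↔ _
    rw [sup_span_cons]
    rfl

theorem RegularChain.hasRegularSeqMod {m : Ideal R} {L : List R} :
    ∀ {J : Ideal R}, RegularChain J L → (∀ f ∈ L, f ∈ m) → HasRegularSeqMod m J L.length := by
  induction L with
  | nil => intros; trivial
  | cons x L ih =>
    intro J hL hm
    rw [regularChain_cons] at hL
    exact ⟨x, hm x (by simp), hL.1, ih hL.2 fun f hf ↦ hm f (by simp [hf])⟩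

end RegularChains

section Homogeneous

variable {K σ : Type*} [Field K]

theorem span_range_X_eq_ker_constantCoeff :
    Ideal.span (Set.range (X : σ → MvPolynomial σ K)) = RingHom.ker constantCoeff := by
  ext f
  rw [← Set.image_univ, mem_ideal_span_X_image, RingHom.mem_ker, constantCoeff_eq,
    ← notMem_support_iff]
  constructor
  · intro h h0
    obtain ⟨i, -, hi⟩ := h 0 h0
    exact hi rfl
  · intro h d hd
    by_contra! hcon
    exact h ((Finsupp.ext fun i ↦ hcon i (Set.mem_univ i) : d = 0) ▸ hd)

attribute [local instance] MvPolynomial.gradedAlgebra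

theorem homogeneousComponent_add_mul_of_isHomogeneous {f g : MvPolynomial σ K} {d e : ℕ}
    (hf : f.IsHomogeneous e) :
    homogeneousComponent (e + d) (f * g) = f * homogeneousComponent d g := by
  have key (p : MvPolynomial σ K) (i : ℕ) :
      (DirectSum.decompose (homogeneousSubmodule σ K) p i : MvPolynomial σ K) =
        homogeneousComponent i p := decomposition.decompose'_apply p i
  rw [← key, ← key]
  exact DirectSum.coe_decompose_mul_add_of_left_mem (homogeneousSubmodule σ K) (i := e)
    (j := d) (b := g) ((mem_homogeneousSubmodule e f).2 hf)

theorem homogeneousComponent_self_mul_of_isHomogeneous {f g : MvPolynomial σ K} {e : ℕ}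
    (hf : f.IsHomogeneous e) :
    homogeneousComponent e (f * g) = C (constantCoeff g) * f := by
  rw [← add_zero e, homogeneousComponent_add_mul_of_isHomogeneous hf, homogeneousComponent_zero,
    mul_comm, constantCoeff_eq]

/-- A homogeneous element is regular modulo a homogeneous ideal if it avoids the associated primes
contained in the irrelevant ideal. -/
theorem regularMod_of_isHomogeneous [Finite σ] {J : Ideal (MvPolynomial σ K)}
    (hJ : J.IsHomogeneous (homogeneousSubmodule σ K)) {f : MvPolynomial σ K} {e : ℕ}
    (hf : f.IsHomogeneous e)
    (h : ∀ q ∈ associatedPrimes _ (MvPolynomial σ K ⧸ J),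
      q ≤ RingHom.ker constantCoeff → f ∉ q) : RegularMod J f := by
  intro g hg
  rw [mem_iff_homogeneousComponent_mem hJ]
  intro d
  by_contra hd
  have : (RingHom.ker (constantCoeff (R := K) (σ := σ))).IsPrime := RingHom.ker_isPrime _
  obtain ⟨q, hq, hqm, hgq⟩ := exists_associatedPrime_le (J := J)
    (m := RingHom.ker (constantCoeff (R := K) (σ := σ))) (u := homogeneousComponent d g) (by
      intro a ha
      by_contra hac
      have h1 := homogeneousComponent_mem_of_mem hJ ha d
      rw [mul_comm, homogeneousComponent_self_mul_of_isHomogeneous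
        (homogeneousComponent_isHomogeneous d g)] at h1
      refine hd ?_
      have h2 := J.mul_mem_left (C (constantCoeff a)⁻¹) h1
      rwa [← mul_assoc, ← C_mul, inv_mul_cancel₀ hac, C_1, one_mul] at h2)
  refine h q hq hqm (hgq f ?_)
  rw [← homogeneousComponent_add_mul_of_isHomogeneous hf]
  exact homogeneousComponent_mem_of_mem hJ hg _

theorem eval_smul_of_isHomogeneous {f : MvPolynomial σ K} {d : ℕ} (hf : f.IsHomogeneous d)
    (t : K) (x : σ → K) : eval (t • x) f = t ^ d * eval x f := by
  rw [eval_eq, eval_eq, Finset.mul_sum]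
  refine Finset.sum_congr rfl fun b hb ↦ ?_
  have hb : ∑ i ∈ b.support, b i = d := by
    rw [← hf (mem_support_iff.1 hb), Finsupp.weight_apply]
    simp [Finsupp.sum]
  simp only [Pi.smul_apply, smul_eq_mul, mul_pow, Finset.prod_mul_distrib,
    Finset.prod_pow_eq_pow_sum, hb]
  ring

theorem eval_homogeneousComponent_eq_zero [Infinite K] {f : MvPolynomial σ K} {x : σ → K}
    (h : ∀ t : K, eval (t • x) f = 0) (d : ℕ) : eval x (homogeneousComponent d f) = 0 := by
  let p : Polynomial K := ∑ i ∈ Finset.range (f.totalDegree + 1),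
    Polynomial.monomial i (eval x (homogeneousComponent i f))
  have hp : p = 0 := by
    refine Polynomial.funext fun t ↦ ?_
    have h1 := h t
    rw [← sum_homogeneousComponent f, map_sum] at h1
    rw [Polynomial.eval_zero, ← h1, Polynomial.eval_finsetSum]
    refine Finset.sum_congr rfl fun i _ ↦ ?_
    have hi := homogeneousComponent_isHomogeneous i f
    rw [Polynomial.eval_monomial, mul_comm]
    exact (eval_smul_of_isHomogeneous hi t x).symm
  by_cases hd : d < f.totalDegree + 1
  · have := congrArg (fun q ↦ Polynomial.coeff q d) hp
    simpa [p, Polynomial.finsetSum_coeff, Polynomial.coeff_monomial, hd, Nat.lt_succ_iff.1 hd]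
      using this
  · rw [homogeneousComponent_eq_zero _ _ (by omega), map_zero]

end Homogeneous

namespace PaperMP

section Points

variable {K : Type} [Field K] {k : ℕ} {n : Fin k → ℕ}

attribute [local instance] MvPolynomial.gradedAlgebra

theorem mem_idealOfPoint {P : MPPoint K k n} {f : MPRing K k n} :
    f ∈ idealOfPoint K k n P ↔ ∀ x ∈ cone K k n P, eval x f = 0 := by
  simp [idealOfPoint, vanishingIdeal, RingHom.mem_ker]

theorem smul_mem_cone {P : MPPoint K k n} {x : Sig k n → K} (hx : x ∈ cone K k n P) (t : K) :
    t • x ∈ cone K k n P := by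
  intro i
  obtain ⟨c, hc⟩ := hx i
  refine ⟨t * c, ?_⟩
  rw [mul_smul, ← hc]
  rfl

theorem isHomogeneous_idealOfSet [Infinite K] (X : Set (MPPoint K k n)) :
    (idealOfSet K k n X).IsHomogeneous (homogeneousSubmodule (Sig k n) K) := by
  refine Ideal.IsHomogeneous.iInf₂ fun P _ d f hf ↦ ?_
  have key : (DirectSum.decompose (homogeneousSubmodule (Sig k n) K) f d : MPRing K k n) =
    homogeneousComponent d f := decomposition.decompose'_apply f d
  rw [key, mem_idealOfPoint]
  exact fun x hx ↦ eval_homogeneousComponent_eq_zero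
    (fun t ↦ mem_idealOfPoint.1 hf _ (smul_mem_cone hx t)) d

/-- The multilinear form `∑ c_j x_{i,j}` of degree `e_i`. -/
def linearForm (i : Fin k) : (Fin (n i + 1) → K) →ₗ[K] MPRing K k n :=
  ∑ j, (LinearMap.proj j).smulRight (X ⟨i, j⟩)

theorem linearForm_apply (i : Fin k) (c : Fin (n i + 1) → K) :
    linearForm (n := n) i c = ∑ j, c j • X ⟨i, j⟩ := by
  simp [linearForm]

theorem linearForm_single (i : Fin k) (j : Fin (n i + 1)) :
    linearForm (K := K) (n := n) i (Pi.single j 1) = X ⟨i, j⟩ := by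
  simp [linearForm_apply, Pi.single_apply, ite_smul]

theorem isWeightedHomogeneous_linearForm (i : Fin k) (c : Fin (n i + 1) → K) :
    IsWeightedHomogeneous (wt k n) (linearForm (n := n) i c) (Pi.single i 1) := by
  rw [linearForm_apply, ← mem_weightedHomogeneousSubmodule]
  exact Submodule.sum_mem _ fun j _ ↦ Submodule.smul_mem _ _
    (isWeightedHomogeneous_X K (wt k n) ⟨i, j⟩)

theorem isHomogeneous_linearForm (i : Fin k) (c : Fin (n i + 1) → K) :
    (linearForm (n := n) i c).IsHomogeneous 1 := by
  rw [linearForm_apply, ← mem_homogeneousSubmodule]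
  exact Submodule.sum_mem _ fun j _ ↦ Submodule.smul_mem _ _ (isHomogeneous_X K _)

theorem eval_linearForm {i : Fin k} {x : Sig k n → K} {t : K} {v : Fin (n i + 1) → K}
    (hx : (fun j ↦ x ⟨i, j⟩) = t • v) (c : Fin (n i + 1) → K) :
    eval x (linearForm (n := n) i c) = t * ∑ j, c j * v j := by
  rw [linearForm_apply, map_sum, Finset.mul_sum]
  refine Finset.sum_congr rfl fun j _ ↦ ?_
  have : x ⟨i, j⟩ = t * v j := congrFun hx j
  rw [smul_eval, eval_X, this]
  ring

/-- Forms of degree `e_i` are proportional modulo the ideal of a point. -/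
theorem linearForm_sub_mem_idealOfPoint (P : MPPoint K k n) (i : Fin k)
    (c d : Fin (n i + 1) → K) :
    (∑ j, d j * (P i).rep j) • linearForm (n := n) i c -
      (∑ j, c j * (P i).rep j) • linearForm i d ∈ idealOfPoint K k n P := by
  refine mem_idealOfPoint.2 fun x hx ↦ ?_
  obtain ⟨t, ht⟩ := hx i
  rw [map_sub, smul_eval, smul_eval, eval_linearForm ht, eval_linearForm ht]
  ring

theorem linearForm_mem_idealOfPoint_of_sum_eq_zero {P : MPPoint K k n} {i : Fin k}
    {c : Fin (n i + 1) → K} (h : ∑ j, c j * (P i).rep j = 0) :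
    linearForm i c ∈ idealOfPoint K k n P := by
  refine mem_idealOfPoint.2 fun x hx ↦ ?_
  obtain ⟨t, ht⟩ := hx i
  rw [eval_linearForm ht, h, mul_zero]

theorem exists_rep_ne_zero (P : MPPoint K k n) (i : Fin k) : ∃ j, (P i).rep j ≠ 0 :=
  Function.ne_iff.1 (P i).rep_nonzero

theorem exists_X_notMem_idealOfPoint (P : MPPoint K k n) (i : Fin k) :
    ∃ j, X ⟨i, j⟩ ∉ idealOfPoint K k n P := by
  obtain ⟨j, hj⟩ := exists_rep_ne_zero P i
  refine ⟨j, fun h ↦ hj ?_⟩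
  simpa using mem_idealOfPoint.1 h (fun p ↦ (P p.1).rep p.2) fun l ↦ ⟨1, by simp⟩

theorem X_mem_of_linearForm_mem {P : MPPoint K k n} {q : Ideal (MPRing K k n)}
    (hPq : idealOfPoint K k n P ≤ q) {i : Fin k} {c : Fin (n i + 1) → K}
    (hcq : linearForm i c ∈ q) (hcP : linearForm i c ∉ idealOfPoint K k n P)
    (j : Fin (n i + 1)) : X ⟨i, j⟩ ∈ q := by
  have hc : ∑ l, c l * (P i).rep l ≠ 0 := fun h ↦ hcP (linearForm_mem_idealOfPoint_of_sum_eq_zero h)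
  have h1 := hPq (linearForm_sub_mem_idealOfPoint P i (Pi.single j 1) c)
  rw [sub_eq_add_neg, q.add_mem_iff_left (neg_mem (Submodule.smul_of_tower_mem q _ hcq)), linearForm_single] at h1
  have h2 := Submodule.smul_of_tower_mem q (∑ l, c l * (P i).rep l)⁻¹ h1
  rwa [smul_smul, inv_mul_cancel₀ hc, one_smul] at h2

theorem ringKrullDim_quotient_le_card {P : MPPoint K k n} {q : Ideal (MPRing K k n)}
    (hPq : idealOfPoint K k n P ≤ q) (T : Finset (Fin k))
    (hT : ∀ l ∉ T, ∀ j, X ⟨l, j⟩ ∈ q) : ringKrullDim (MPRing K k n ⧸ q) ≤ T.card := by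
  choose j₀ hj₀ using exists_rep_ne_zero P
  let φ : MvPolynomial T K →ₐ[K] MPRing K k n ⧸ q :=
    aeval fun l ↦ Ideal.Quotient.mk q (X ⟨l, j₀ l⟩)
  let ψ : MPRing K k n →ₐ[K] MvPolynomial T K :=
    aeval fun p ↦ if h : p.1 ∈ T then
      ((P p.1).rep (j₀ p.1))⁻¹ • (P p.1).rep p.2 • X ⟨p.1, h⟩ else 0
  have hφψ : φ.comp ψ = Ideal.Quotient.mkₐ K q := by
    refine algHom_ext fun p ↦ ?_
    obtain ⟨l, j⟩ := p
    by_cases hl : l ∈ T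
    · have h1 := hPq (linearForm_sub_mem_idealOfPoint P l (Pi.single j 1) (Pi.single (j₀ l) 1))
      rw [← Ideal.Quotient.eq_zero_iff_mem, linearForm_single, linearForm_single, map_sub,
        sub_eq_zero] at h1
      simp only [Pi.single_apply, ite_mul, one_mul, zero_mul, Finset.sum_ite_eq',
        Finset.mem_univ, if_true] at h1
      have h2 := congrArg (((P l).rep (j₀ l))⁻¹ • ·) h1
      change ((P l).rep (j₀ l))⁻¹ • ((P l).rep (j₀ l)) • Ideal.Quotient.mk q (X ⟨l, j⟩) =
        ((P l).rep (j₀ l))⁻¹ • ((P l).rep j) • Ideal.Quotient.mk q (X ⟨l, j₀ l⟩) at h2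
      rw [inv_smul_smul₀ (hj₀ l)] at h2
      simp [φ, ψ, hl, h2]
    · simpa [φ, ψ, hl] using (Ideal.Quotient.eq_zero_iff_mem.2 (hT l hl j)).symm
  have hφ : Function.Surjective φ := by
    intro y
    obtain ⟨f, rfl⟩ := Ideal.Quotient.mk_surjective y
    exact ⟨ψ f, DFunLike.congr_fun hφψ f⟩
  refine (ringKrullDim_le_of_surjective φ.toRingHom hφ).trans ?_
  rw [MvPolynomial.ringKrullDim_of_isNoetherianRing, ringKrullDim_eq_zero_of_field, zero_add,
    Nat.card_eq_fintype_card, Fintype.card_coe]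

theorem exists_linearForm_notMem [Infinite K] (i : Fin k) {S : Set (Ideal (MPRing K k n))}
    (hS : S.Finite) (h : ∀ q ∈ S, ∃ j, X ⟨i, j⟩ ∉ q) :
    ∃ c : Fin (n i + 1) → K, ∀ q ∈ S, linearForm i c ∉ q := by
  by_contra! hcon
  have : Finite S := hS
  obtain ⟨q, hq⟩ := Subspace.exists_eq_top_of_iUnion_eq_univ (k := K) (ι := S)
    (p := fun q ↦ (q.1.restrictScalars K).comap (linearForm i)) (by
      refine Set.eq_univ_of_forall fun c ↦ ?_
      obtain ⟨q, hq, hc⟩ := hcon c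
      exact Set.mem_iUnion.2 ⟨⟨q, hq⟩, hc⟩)
  obtain ⟨j, hj⟩ := h q q.2
  have hmem : (Pi.single j 1 : Fin (n i + 1) → K) ∈
      (q.1.restrictScalars K).comap (linearForm i) := hq ▸ Submodule.mem_top
  rw [Submodule.mem_comap, linearForm_single] at hmem
  exact hj hmem

theorem exists_idealOfPoint_le {X : Set (MPPoint K k n)} (hX : X.Finite)
    {q : Ideal (MPRing K k n)} (hq : q.IsPrime) (h : idealOfSet K k n X ≤ q) :
    ∃ P ∈ X, idealOfPoint K k n P ≤ q := by
  obtain ⟨P, hP, hPq⟩ := (hq.inf_le' (s := hX.toFinset) (f := idealOfPoint K k n)).1 (by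
    refine le_trans (le_of_eq ?_) h
    simp [idealOfSet, Finset.inf_eq_iInf])
  exact ⟨P, hX.mem_toFinset.1 hP, hPq⟩

instance isMaximal_maxIdeal : (maxIdeal K k n).IsMaximal := by
  rw [maxIdeal, span_range_X_eq_ker_constantCoeff]
  exact RingHom.ker_isMaximal_of_surjective _ fun a ↦ ⟨C a, constantCoeff_C _ a⟩

theorem linearForm_mem_maxIdeal (i : Fin k) (c : Fin (n i + 1) → K) :
    linearForm i c ∈ maxIdeal K k n := by
  rw [linearForm_apply]
  exact Ideal.sum_mem _ fun j _ ↦ Submodule.smul_of_tower_mem _ _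
    (Ideal.subset_span ⟨_, rfl⟩)

/-- A partial regular sequence of forms of degrees `e_1, …, e_i` modulo the ideal of an ACM set
of points, generating `J` together with that ideal, extends to forms of all the degrees. -/
theorem exists_regularChain [Infinite K] {X : Set (MPPoint K k n)} (hX : X.Finite) (r : ℕ) :
    ∀ (i : ℕ) (_ : i + r = k) (J : Ideal (MPRing K k n)),
      J.IsHomogeneous (homogeneousSubmodule (Sig k n) K) → idealOfSet K k n X ≤ J →
      (∀ P ∈ X, ∀ q : Ideal (MPRing K k n), J ≤ q → idealOfPoint K k n P ≤ q →
        ∀ l : Fin k, l.val < i → ∀ j, MvPolynomial.X ⟨l, j⟩ ∈ q) →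
      HasRegularSeqMod (maxIdeal K k n) J r →
      ∃ L : List (MPRing K k n), L.length = r ∧ RegularChain J L ∧
        (∀ f ∈ L, f ∈ maxIdeal K k n) ∧
        ∀ (a : ℕ) (ha : a < L.length) (hk : i + a < k),
          IsWeightedHomogeneous (wt k n) L[a] (Pi.single ⟨i + a, hk⟩ 1) := by
  induction r with
  | zero => exact fun i _ J _ _ _ _ ↦ ⟨[], by simp, fun i ↦ i.elim0, by simp, by simp⟩
  | succ r ih =>
    intro i hi J hJ hXJ hvar hreg
    let i' : Fin k := ⟨i, by omega⟩
    obtain ⟨c, hc⟩ := exists_linearForm_notMem i'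
      (S := {q ∈ associatedPrimes _ (MPRing K k n ⧸ J) | q ≤ maxIdeal K k n} ∪
        idealOfPoint K k n '' X)
      (((associatedPrimes.finite _ _).subset (Set.sep_subset _ _)).union (hX.image _)) (by
        rintro q (⟨hq, hqm⟩ | ⟨P, -, rfl⟩)
        · by_contra! hall
          have hJq : J ≤ q := by
            obtain ⟨-, w, hw⟩ := mem_associatedPrimes_quotient_iff.1 hq
            exact fun a ha ↦ (hw a).2 (J.mul_mem_right w ha)
          obtain ⟨P, hP, hPq⟩ := exists_idealOfPoint_le hX hq.isPrime (hXJ.trans hJq)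
          have h1 := hreg.le_ringKrullDim hq hqm
          have h2 := ringKrullDim_quotient_le_card hPq (Finset.Ioi i') (by
            intro l hl j
            rw [Finset.mem_Ioi, not_lt] at hl
            obtain rfl | hl := hl.eq_or_lt
            · exact hall j
            · exact hvar P hP q hJq hPq l hl j)
          rw [Fin.card_Ioi] at h2
          have h3 : r + 1 ≤ k - 1 - i := by exact_mod_cast h1.trans h2
          omega
        · exact exists_X_notMem_idealOfPoint P i')
    have hmem := linearForm_mem_maxIdeal (K := K) (n := n) i' c
    have hreg' : RegularMod J (linearForm i' c) :=
      regularMod_of_isHomogeneous hJ (isHomogeneous_linearForm i' c) fun q hq hqm ↦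
        hc q (Or.inl ⟨hq, by rwa [maxIdeal, span_range_X_eq_ker_constantCoeff]⟩)
    obtain ⟨L, hLr, hL, hLm, hLhom⟩ := ih (i + 1) (by omega)
      (J ⊔ Ideal.span {linearForm i' c})
      (hJ.sup (Ideal.homogeneous_span _ _ (by
        rintro _ rfl
        exact ⟨1, isHomogeneous_linearForm i' c⟩)))
      (hXJ.trans le_sup_left)
      (by
        intro P hP q hq hPq l hl j
        rw [sup_le_iff, Ideal.span_singleton_le_iff_mem] at hq
        obtain hl | hl := (Nat.lt_succ_iff.1 hl).lt_or_eq
        · exact hvar P hP q hq.1 hPq l hl j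
        · obtain rfl : l = i' := Fin.ext hl
          exact X_mem_of_linearForm_mem hPq hq.2 (hc _ (Or.inr ⟨P, hP, rfl⟩)) j)
      (hreg.sup_span hmem hreg')
    refine ⟨linearForm i' c :: L, by simp [hLr], regularChain_cons.2 ⟨hreg', hL⟩,
      by simpa using ⟨hmem, hLm⟩, fun a ha hk ↦ ?_⟩
    cases a with
    | zero => exact isWeightedHomogeneous_linearForm i' c
    | succ a =>
      have := hLhom a (by simpa using ha) (by omega)
      simpa only [List.getElem_cons_succ, add_assoc, add_comm 1 a] using this

end Points

/-- an ACM set of points of `ℙ^{n_1} × ⋯ × ℙ^{n_k}` admits a regular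
sequence `L_1,…,L_k` modulo `I_X` with `deg L_i = e_i`. -/
theorem statement_3 (K : Type) [Field K] [IsAlgClosed K] [CharZero K]
    (k : ℕ) (n : Fin k → ℕ)
    (X : Set (MPPoint K k n)) (hX : X.Finite) (hACM : IsACM K k n X) :
    ∃ L : Fin k → MPRing K k n,
      (∀ i : Fin k, MvPolynomial.IsWeightedHomogeneous (wt k n) (L i) (Pi.single i 1)) ∧
      IsRegSeqMod K k n (idealOfSet K k n X) (List.ofFn L) := by
  obtain ⟨⟨A, hAk, hAm, hA⟩, -⟩ := hACM
  rw [sup_le_iff, Ideal.span_le] at hAm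
  have hdepth := RegularChain.hasRegularSeqMod (L := A) hA fun f hf ↦ hAm.2 hf
  rw [hAk] at hdepth
  obtain ⟨L, hLk, hL, hLm, hLhom⟩ := exists_regularChain hX k 0 (zero_add k) _
    (isHomogeneous_idealOfSet X) le_rfl (by simp) hdepth
  have hofFn : List.ofFn (fun i : Fin k ↦ L[i.val]) = L :=
    List.ext_getElem (by simp [hLk]) (by simp)
  refine ⟨fun i ↦ L[i.val], fun i ↦ ?_, ?_⟩
  · simpa using hLhom i (by omega) (by omega)
  · rw [hofFn]
    exact ⟨sup_le hAm.1 (Ideal.span_le.2 hLm), hL⟩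

end PaperMP
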